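/- Let a, b, c be integers with a·c ≠ 0 and a·c + b even. Then the generalized quadratic Gauss sum satisfies the reciprocity formula: ∑_{r=0}^{|c|-1} e^{πi(a r² + b r)/c} = |c/a|^{1/2} · e^{πi(|ac| - b²)/(4ac)} · ∑_{r=0}^{|a|-1} e^{-πi(c r² + b r)/a}. -/

import Mathlib

open Complex Finset

lemma gsr_split (F : ℤ → ℂ) (hF : Summable F) (N : ℕ) (hN : 0 < N) :
    ∑' n, F n = ∑ r ∈ Finset.range N, ∑' m : ℤ, F (m * N + (r : ℕ)) := by
  have : NeZero N := ⟨hN.ne'⟩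
  have h1 : Summable (fun p : ℤ × Fin N => F (p.1 * N + (p.2 : ℕ))) := by
    have := (Int.divModEquiv N).symm.summable_iff.mpr hF
    refine this.congr fun p => ?_
    simp [Int.divModEquiv_symm_apply]
  have h2 : ∑' n, F n = ∑' p : ℤ × Fin N, F (p.1 * N + (p.2 : ℕ)) := by
    rw [← (Int.divModEquiv N).symm.tsum_eq F]
    refine tsum_congr fun p => ?_
    simp [Int.divModEquiv_symm_apply]
  have h4 : Summable (fun p : Fin N × ℤ => F (p.2 * N + (p.1 : ℕ))) := by
    have := (Equiv.prodComm (Fin N) ℤ).summable_iff.mpr h1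
    exact this
  have h3 : ∑' p : ℤ × Fin N, F (p.1 * N + (p.2 : ℕ))
      = ∑' p : Fin N × ℤ, F (p.2 * N + (p.1 : ℕ)) :=
    ((Equiv.prodComm (Fin N) ℤ).tsum_eq (fun p : ℤ × Fin N => F (p.1 * N + (p.2 : ℕ)))).symm
  have h5 := h4.tsum_prod
  rw [h2, h3, h5, tsum_fintype (L := SummationFilter.unconditional _)]
  exact (Finset.sum_range (fun r : ℕ => ∑' m : ℤ, F (m * N + (r : ℕ)))).symm

lemma gsr_fe (N : ℕ) (hN : 0 < N) (s : ℝ) (r : ℕ) (u : ℂ) (hu : 0 < u.re) :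
    ∑' m : ℤ, cexp (-Real.pi * (((m * N + (r : ℕ) : ℤ) : ℂ) + s) ^ 2 / (N ^ 2 * u))
      = u ^ (1 / 2 : ℂ) * jacobiTheta₂ (((-(r + s) / N : ℝ)) : ℂ) (I * u) := by
  have hu0 : u ≠ 0 := by rintro rfl; simp at hu
  have hN0 : (N : ℂ) ≠ 0 := by exact_mod_cast hN.ne'
  have hp : u ^ (1 / 2 : ℂ) ≠ 0 := by simp [cpow_eq_zero_iff, hu0]
  rw [jacobiTheta₂_functional_equation, show -I * (I * u) = u by
    rw [← mul_assoc, neg_mul, I_mul_I]; ring]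
  rw [← mul_assoc, ← mul_assoc, mul_one_div_cancel hp, one_mul, jacobiTheta₂, ← tsum_mul_left]
  refine tsum_congr fun m => ?_
  rw [jacobiTheta₂_term, ← Complex.exp_add]
  congr 1
  push_cast
  have hI : (I : ℂ) ≠ 0 := I_ne_zero
  field_simp
  ring_nf

lemma gsr_lim {ι : Type*} (l : Filter ι) [l.IsCountablyGenerated] (x : ℝ) (τ : ι → ℂ)
    (h : Filter.Tendsto (fun i => (τ i).im) l Filter.atTop) :
    Filter.Tendsto (fun i => jacobiTheta₂ (x : ℂ) (τ i)) l (nhds 1) := by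
  have h0 : (1 : ℂ) = ∑' n : ℤ, if n = 0 then 1 else 0 := by simp
  rw [h0]
  unfold jacobiTheta₂
  refine tendsto_tsum_of_dominated_convergence
    (bound := fun n : ℤ => Real.exp (-Real.pi * (1 * n ^ 2 - 2 * 0 * |n|))) ?_ ?_ ?_
  · simpa using summable_pow_mul_jacobiTheta₂_term_bound 0 one_pos 0
  · intro n
    split_ifs with hn
    · simpa [hn, jacobiTheta₂_term] using tendsto_const_nhds
    · rw [tendsto_zero_iff_norm_tendsto_zero]
      simp only [norm_jacobiTheta₂_term, ofReal_im, mul_zero, sub_zero]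
      refine Real.tendsto_exp_atBot.comp ?_
      have : (-Real.pi * (n : ℝ) ^ 2) < 0 := by
        have : (0 : ℝ) < (n : ℝ) ^ 2 := by positivity
        nlinarith [Real.pi_pos]
      exact h.const_mul_atTop_of_neg this
  · filter_upwards [h.eventually_ge_atTop 1] with i hi n
    exact norm_jacobiTheta₂_term_le one_pos (by simp) hi n

lemma gsr_cpow (σ : ℝ) (hσ : σ = 1 ∨ σ = -1) (ρ : ℝ) (hρ : 0 < ρ) (u : ℂ) (hu : 0 < u.re) :
    (-I * σ * ρ * u) ^ (1 / 2 : ℂ)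
      = (Real.sqrt ρ : ℂ) * cexp (-Real.pi * I * σ / 4) * u ^ (1 / 2 : ℂ) := by
  have hu0 : u ≠ 0 := by rintro rfl; simp at hu
  have harg := abs_lt.mp ((Complex.abs_arg_lt_pi_div_two_iff).mpr (Or.inl hu))
  have hρ0 : (ρ : ℂ) ≠ 0 := by exact_mod_cast hρ.ne'
  have hσI : cexp (-(Real.pi * σ / 2 : ℝ) * I) = -I * σ := by
    rcases hσ with rfl | rfl
    · rw [← Complex.exp_neg_pi_div_two_mul_I]; push_cast; ring_nf
    · push_cast
      rw [show -((Real.pi : ℂ) * -1 / 2) * I = Real.pi / 2 * I by ring,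
        Complex.exp_pi_div_two_mul_I]; ring
  have hexp : cexp ((Real.log ρ : ℝ) + -(Real.pi * σ / 2 : ℝ) * I + log u) = -I * σ * ρ * u := by
    rw [Complex.exp_add, Complex.exp_add, Complex.exp_log hu0, hσI, ← Complex.ofReal_exp,
      Real.exp_log hρ]
    ring
  have him : ((Real.log ρ : ℝ) + -(Real.pi * σ / 2 : ℝ) * I + log u).im
      = -(Real.pi * σ / 2) + u.arg := by
    rw [← ofReal_neg, add_im, add_im, ofReal_im, im_ofReal_mul,
      I_im, log_im]; ring
  have hlog : log (-I * σ * ρ * u) = (Real.log ρ : ℝ) + -(Real.pi * σ / 2 : ℝ) * I + log u := by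
    rw [← hexp, Complex.log_exp]
    · rw [him]; rcases hσ with rfl | rfl <;> linarith [Real.pi_pos]
    · rw [him]; rcases hσ with rfl | rfl <;> linarith [Real.pi_pos]
  have hne : -I * σ * ρ * u ≠ 0 := by rw [← hexp]; exact Complex.exp_ne_zero _
  have hs : (Real.sqrt ρ : ℂ) = cexp ((Real.log ρ : ℝ) / 2) := by
    rw [Real.sqrt_eq_rpow, Real.rpow_def_of_pos hρ]; push_cast; ring_nf
  rw [cpow_def_of_ne_zero hne, cpow_def_of_ne_zero hu0, hlog, hs, ← Complex.exp_add,
    ← Complex.exp_add]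
  congr 1
  push_cast
  ring

lemma gsr_sum (N : ℕ) (hN : 0 < N) (s : ℝ) (u : ℂ) (hu : 0 < u.re) (f : ℤ → ℂ)
    (hf : ∀ (m : ℤ) (r : ℕ), f (m * N + r) = f r)
    (hs : Summable fun n : ℤ => f n * cexp (-Real.pi * ((n : ℂ) + s) ^ 2 / (N ^ 2 * u))) :
    ∑' n : ℤ, f n * cexp (-Real.pi * ((n : ℂ) + s) ^ 2 / (N ^ 2 * u))
      = u ^ (1 / 2 : ℂ) *
        ∑ r ∈ Finset.range N, f r * jacobiTheta₂ (((-(r + s) / N : ℝ)) : ℂ) (I * u) := by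
  rw [gsr_split _ hs N hN, Finset.mul_sum]
  refine Finset.sum_congr rfl fun r _ => ?_
  simp only [hf]
  rw [tsum_mul_left, gsr_fe N hN s r u hu]
  ring

lemma gsr_per (a b c : ℤ) (hc : c ≠ 0) (hev : Even (a * c + b)) (m r : ℤ) :
    cexp (Real.pi * I * (a * ((m * c + r : ℤ) : ℂ) ^ 2 + b * ((m * c + r : ℤ) : ℂ)) / c)
      = cexp (Real.pi * I * (a * (r : ℂ) ^ 2 + b * (r : ℂ)) / c) := by
  obtain ⟨k, hk⟩ := hev
  obtain ⟨j, hj⟩ := Int.even_mul_succ_self (m - 1)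
  rw [Complex.exp_eq_exp_iff_exists_int]
  refine ⟨a * c * j + k * m + a * m * r, ?_⟩
  have hc' : (c : ℂ) ≠ 0 := by exact_mod_cast hc
  have hk' : (a : ℂ) * c + b = k + k := by exact_mod_cast hk
  have hj' : ((m : ℂ) - 1) * (m - 1 + 1) = j + j := by exact_mod_cast hj
  push_cast
  field_simp
  linear_combination (c * m : ℂ) * hk' + (a * c * c : ℂ) * hj'

lemma gsr_main (a b : ℤ) (c : ℕ) (ha : a ≠ 0) (hc : 0 < c) (hev : Even (a * c + b)) :
    (∑ r ∈ Finset.range c,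
        cexp (Real.pi * I * (a * (r : ℂ) ^ 2 + b * (r : ℂ)) / c))
      = (Real.sqrt (c / |(a : ℝ)|) : ℂ) * cexp (Real.pi * I * (SignType.sign a : ℤ) / 4)
        * cexp (- (Real.pi * I * b ^ 2 / (4 * a * c)))
        * ∑ r ∈ Finset.range a.natAbs,
            cexp (-(Real.pi * I * (c * (r : ℂ) ^ 2 + b * (r : ℂ)) / a)) := by
  set f : ℤ → ℂ := fun n => cexp (Real.pi * I * (a * (n : ℂ) ^ 2 + b * (n : ℂ)) / c) with hfdef
  set g : ℤ → ℂ := fun n => cexp (-(Real.pi * I * (c * (n : ℂ) ^ 2 + b * (n : ℂ)) / a)) with hgdef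
  have hcC : (c : ℂ) ≠ 0 := by exact_mod_cast hc.ne'
  have haC : (a : ℂ) ≠ 0 := by exact_mod_cast ha
  have haR : (a : ℝ) ≠ 0 := by exact_mod_cast ha
  have hcR : (0 : ℝ) < c := by exact_mod_cast hc
  have hN : 0 < a.natAbs := Int.natAbs_pos.mpr ha
  have hN2 : ((a.natAbs : ℕ) : ℂ) ^ 2 = (a : ℂ) ^ 2 := by
    have h := congrArg (fun k : ℤ => (k : ℂ)) (Int.natAbs_sq a)
    simp only [Int.cast_pow, Int.cast_natCast] at h
    exact h
  have hf : ∀ (m : ℤ) (r : ℕ), f (m * c + r) = f r := by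
    intro m r
    have := gsr_per a b c (by exact_mod_cast hc.ne') hev m r
    simpa [hfdef] using this
  have hg : ∀ (m : ℤ) (r : ℕ), g (m * a.natAbs + r) = g r := by
    intro m r
    have key : ∀ m : ℤ, g (m * a + r) = g r := by
      intro m
      have := gsr_per c b a ha (by rwa [mul_comm]) m r
      simp only [hgdef, Complex.exp_neg]
      simpa using this
    rcases Int.natAbs_eq a with h | h
    · rw [← h]; exact key m
    · rw [show m * (a.natAbs : ℤ) = (-m) * a by rw [h]; simp]; exact key (-m)
  set K : ℂ := (Real.sqrt (c / |(a : ℝ)|) : ℂ) * cexp (Real.pi * I * (SignType.sign a : ℤ) / 4)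
        * cexp (- (Real.pi * I * b ^ 2 / (4 * a * c))) with hK
  let A : ℝ → ℂ := fun T => ∑ r ∈ Finset.range c,
    f r * jacobiTheta₂ (((-(r + (0 : ℝ)) / c : ℝ)) : ℂ) (I * (T : ℂ))
  let B : ℝ → ℂ := fun T => ∑ r ∈ Finset.range a.natAbs,
    g r * jacobiTheta₂ (((-(r + (b / (2 * c) : ℝ)) / a.natAbs : ℝ)) : ℂ)
      (I * ((T : ℂ) + I / (a * c)))
  have hu_re : ∀ T : ℝ, ((T : ℂ) + I / (a * c)).re = T := by
    intro T
    have : I / ((a : ℂ) * c) = ((1 / (a * c) : ℝ) : ℂ) * I := by push_cast; ring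
    rw [this]; simp
  have hAlim : Filter.Tendsto A Filter.atTop (nhds (∑ r ∈ Finset.range c, f r)) := by
    refine tendsto_finsetSum _ fun r _ => ?_
    have := (gsr_lim Filter.atTop (-(r + (0 : ℝ)) / c) (fun T : ℝ => I * (T : ℂ))
      (by simp only [I_mul_im, ofReal_re]; exact Filter.tendsto_id)).const_mul (f r)
    simpa using this
  have hBlim : Filter.Tendsto B Filter.atTop (nhds (∑ r ∈ Finset.range a.natAbs, g r)) := by
    refine tendsto_finsetSum _ fun r _ => ?_
    have := (gsr_lim Filter.atTop (-(r + (b / (2 * c) : ℝ)) / a.natAbs)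
      (fun T : ℝ => I * ((T : ℂ) + I / (a * c)))
      (by simp only [I_mul_im, hu_re]; exact Filter.tendsto_id)).const_mul (g r)
    rw [mul_one] at this
    exact this
  have hAB : ∀ T : ℝ, 0 < T → A T = K * B T := by
    intro T hT
    have hTC : (T : ℂ) ≠ 0 := by exact_mod_cast hT.ne'
    set u : ℂ := (T : ℂ) + I / (a * c) with hu
    have hure : 0 < u.re := by rw [hu, hu_re]; exact hT
    have hu0 : u ≠ 0 := by intro h; rw [h] at hure; simp at hure
    set τ : ℂ := a / c + I / (c ^ 2 * T) with hτ
    set z : ℂ := b / (2 * c) with hz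
    have hτu : τ = a / (c * T) * u := by
      rw [hτ, hu]; field_simp
    have hτim : 0 < τ.im := by
      have : τ = ((a / c : ℝ) : ℂ) + ((1 / (c ^ 2 * T) : ℝ) : ℂ) * I := by
        rw [hτ]; push_cast; ring
      rw [this, add_im, ofReal_im, im_ofReal_mul, I_im]
      positivity
    have hτ_neg_im : 0 < (-1 / τ).im := by
      rw [neg_div, neg_im, one_div, inv_im, neg_div, neg_neg]
      exact div_pos hτim (normSq_pos.mpr (by rintro h; rw [h] at hτim; simp at hτim))
    have hIsq : I * I = -1 := I_mul_I
    have t1 : ∀ n : ℤ, jacobiTheta₂_term n z τ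
        = f n * cexp (-Real.pi * ((n : ℂ) + (0 : ℝ)) ^ 2 / (c ^ 2 * T)) := by
      intro n
      rw [jacobiTheta₂_term, hfdef, ← Complex.exp_add]
      congr 1
      rw [hτ, hz]
      push_cast
      field_simp
      linear_combination (n ^ 2 : ℂ) * hIsq
    have t2 : ∀ n : ℤ, cexp (-Real.pi * I * (-z) ^ 2 / τ)
          * jacobiTheta₂_term n (-z / τ) (-1 / τ)
        = cexp (- (Real.pi * I * b ^ 2 / (4 * a * c))) * (g n * cexp (-Real.pi * ((n : ℂ) + (b / (2 * c) : ℝ)) ^ 2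
          / ((a.natAbs : ℂ) ^ 2 * u))) := by
      intro n
      rw [jacobiTheta₂_term, hgdef, ← Complex.exp_add, ← Complex.exp_add, ← Complex.exp_add, hN2]
      congr 1
      have hT' : (T : ℂ) = u - I / (a * c) := by rw [hu]; ring
      rw [hτu, hz]
      push_cast
      field_simp
      rw [hT']
      field_simp
      ring_nf
      try simp only [I_sq]
      try ring
    have s1 : jacobiTheta₂ z τ = (T : ℂ) ^ (1 / 2 : ℂ) * A T := by
      have hs := (summable_jacobiTheta₂_term_iff z τ).mpr hτim
      rw [jacobiTheta₂]
      simp only [t1] at hs ⊢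
      exact gsr_sum c hc 0 T (by simpa using hT) f hf hs
    have s2 : cexp (-Real.pi * I * (-z) ^ 2 / τ) * jacobiTheta₂ (-z / τ) (-1 / τ)
        = cexp (- (Real.pi * I * b ^ 2 / (4 * a * c))) * (u ^ (1 / 2 : ℂ) * B T) := by
      have hs := ((summable_jacobiTheta₂_term_iff (-z / τ) (-1 / τ)).mpr hτ_neg_im).mul_left
        (cexp (-Real.pi * I * (-z) ^ 2 / τ))
      rw [jacobiTheta₂, ← tsum_mul_left]
      simp only [t2] at hs ⊢
      rw [tsum_mul_left]
      congr 1
      refine gsr_sum a.natAbs hN _ u hure g hg ?_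
      exact (summable_mul_left_iff (Complex.exp_ne_zero _)).mp hs
    have fe := jacobiTheta₂_functional_equation (-z) τ
    rw [jacobiTheta₂_neg_left, s1, mul_assoc, s2] at fe
    obtain ⟨σ, hσ, hσa, hσs⟩ : ∃ σ : ℝ, (σ = 1 ∨ σ = -1) ∧ (a : ℝ) = σ * |(a : ℝ)| ∧
        ((SignType.sign a : ℤ) : ℂ) = (σ : ℂ) := by
      rcases lt_or_gt_of_ne ha with h | h
      · refine ⟨-1, Or.inr rfl, ?_, ?_⟩
        · rw [abs_of_neg (by exact_mod_cast h)]; ring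
        · simp [sign_neg h]
      · refine ⟨1, Or.inl rfl, ?_, ?_⟩
        · rw [abs_of_pos (by exact_mod_cast h)]; ring
        · simp [sign_pos h]
    have habs : 0 < |(a : ℝ)| := abs_pos.mpr haR
    have hτc : -I * τ = -I * σ * ((|(a : ℝ)| / (c * T) : ℝ) : ℂ) * u := by
      have : (a : ℂ) = (σ : ℂ) * ((|(a : ℝ)| : ℝ) : ℂ) := by exact_mod_cast hσa
      rw [hτu, this]; push_cast; ring
    have hρ : 0 < |(a : ℝ)| / (c * T) := by positivity
    rw [hτc, gsr_cpow σ hσ _ hρ u hure] at fe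
    have hT12 : (T : ℂ) ^ (1 / 2 : ℂ) = (Real.sqrt T : ℂ) := by
      rw [Real.sqrt_eq_rpow, Complex.ofReal_cpow hT.le]; norm_num
    have hsq : (Real.sqrt (c / |(a : ℝ)|) : ℂ) * (Real.sqrt (|(a : ℝ)| / (c * T)) : ℂ)
        * (Real.sqrt T : ℂ) = 1 := by
      rw [← ofReal_mul, ← ofReal_mul, ← Real.sqrt_mul (by positivity),
        ← Real.sqrt_mul (by positivity)]
      rw [show (c : ℝ) / |(a : ℝ)| * (|(a : ℝ)| / (c * T)) * T = 1 by field_simp]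
      simp
    have hee : cexp (Real.pi * I * σ / 4) * cexp (-Real.pi * I * σ / 4) = 1 := by
      rw [← Complex.exp_add, ← Complex.exp_zero]; congr 1; ring
    have hup : u ^ (1 / 2 : ℂ) ≠ 0 := by simp [cpow_eq_zero_iff, hu0]
    rw [hT12] at fe
    rw [hK, hσs]
    have n1 : (Real.sqrt T : ℂ) ≠ 0 := right_ne_zero_of_mul_eq_one hsq
    have n2 : (Real.sqrt (|(a : ℝ)| / (c * T)) : ℂ) ≠ 0 := by
      have := left_ne_zero_of_mul_eq_one hsq
      exact right_ne_zero_of_mul this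
    have n3 : cexp (-Real.pi * I * σ / 4) ≠ 0 := Complex.exp_ne_zero _
    generalize cexp (-Real.pi * I * σ / 4) = e1 at *
    generalize cexp (Real.pi * I * σ / 4) = e2 at *
    generalize cexp (- (Real.pi * I * b ^ 2 / (4 * a * c))) = E at *
    generalize (Real.sqrt (|(a : ℝ)| / (c * T)) : ℂ) = q at *
    generalize (Real.sqrt (c / |(a : ℝ)|) : ℂ) = p at *
    generalize (Real.sqrt T : ℂ) = t at *
    generalize u ^ (1 / 2 : ℂ) = v at *
    have fe2 : t * q * e1 * A T = E * B T := by
      field_simp at fe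
      linear_combination fe
    have : A T = (p * q * t) * (e2 * e1) * A T := by rw [hsq, hee]; ring
    rw [this]
    linear_combination (p * e2) * fe2
  have hKB := hBlim.const_mul K
  have := tendsto_nhds_unique (hKB.congr' ?_) hAlim
  · rw [← hK] at *
    simpa [hfdef, hgdef] using this.symm
  · filter_upwards [Filter.eventually_gt_atTop 0] with T hT
    exact (hAB T hT).symm

lemma gsr_pos (a b c : ℤ) (ha : a ≠ 0) (hc : 0 < c) (hev : Even (a * c + b)) :
    (∑ r ∈ Finset.range c.natAbs,
        Complex.exp ((Real.pi : ℂ) * Complex.I * ((a : ℂ) * (r : ℂ) ^ 2 + (b : ℂ) * (r : ℂ)) / (c : ℂ)))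
      = (Real.sqrt |(c : ℝ) / (a : ℝ)| : ℂ)
        * Complex.exp ((Real.pi : ℂ) * Complex.I * ((|a * c| : ℤ) - (b : ℂ) ^ 2) / (4 * (a : ℂ) * (c : ℂ)))
        * ∑ r ∈ Finset.range a.natAbs,
            Complex.exp (-((Real.pi : ℂ) * Complex.I * ((c : ℂ) * (r : ℂ) ^ 2 + (b : ℂ) * (r : ℂ)) / (a : ℂ))) := by
  lift c to ℕ using hc.le
  have hc' : 0 < c := by exact_mod_cast hc
  have h := gsr_main a b c ha hc' hev
  have hcC : (c : ℂ) ≠ 0 := by exact_mod_cast hc'.ne'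
  have haC : (a : ℂ) ≠ 0 := by exact_mod_cast ha
  simp only [Int.natAbs_natCast, Int.cast_natCast]
  rw [h, abs_div, Nat.abs_cast, mul_assoc (Real.sqrt _ : ℂ), ← Complex.exp_add]
  congr 3
  have habs : ((|a * (c : ℤ)| : ℤ) : ℂ) = (SignType.sign a : ℤ) * a * c := by
    rw [abs_mul, Nat.abs_cast, ← sign_mul_self a]; push_cast; ring
  rw [habs]
  field_simp
  ring

/-- Reciprocity formula for generalised quadratic Gauss sums: for integers `a`, `b`, `c`
with `ac ≠ 0` and `ac + b` even,
`∑_{r=0}^{|c|-1} e^{πi(ar²+br)/c}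
  = |c/a|^{1/2} e^{πi(|ac|-b²)/(4ac)} ∑_{r=0}^{|a|-1} e^{-πi(cr²+br)/a}`. -/
theorem gauss_sum_reciprocity (a b c : ℤ) (hac : a * c ≠ 0) (hev : Even (a * c + b)) :
    (∑ r ∈ Finset.range c.natAbs,
        Complex.exp ((Real.pi : ℂ) * Complex.I * ((a : ℂ) * (r : ℂ) ^ 2 + (b : ℂ) * (r : ℂ)) / (c : ℂ)))
      = (Real.sqrt |(c : ℝ) / (a : ℝ)| : ℂ)
        * Complex.exp ((Real.pi : ℂ) * Complex.I * ((|a * c| : ℤ) - (b : ℂ) ^ 2) / (4 * (a : ℂ) * (c : ℂ)))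
        * ∑ r ∈ Finset.range a.natAbs,
            Complex.exp (-((Real.pi : ℂ) * Complex.I * ((c : ℂ) * (r : ℂ) ^ 2 + (b : ℂ) * (r : ℂ)) / (a : ℂ))) := by
  have ha : a ≠ 0 := left_ne_zero_of_mul hac
  have hc : c ≠ 0 := right_ne_zero_of_mul hac
  rcases lt_or_gt_of_ne hc with h | h
  · have hev' : Even ((-a) * (-c) + (-b)) := by
      have : (-a) * (-c) + (-b) = (a * c + b) - 2 * b := by ring
      rw [this]
      exact hev.sub (even_two_mul b)
    have key := gsr_pos (-a) (-b) (-c) (neg_ne_zero.mpr ha) (by omega) hev'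
    have e1 : ∀ x y w z : ℂ, w * (-x * z ^ 2 + -y * z) / -(c : ℂ) = w * (x * z ^ 2 + y * z) / c := by
      intro x y w z
      rw [div_neg, ← neg_div]; ring
    have e2 : ∀ x y w z : ℂ, w * (-x * z ^ 2 + -y * z) / -(a : ℂ) = w * (x * z ^ 2 + y * z) / a := by
      intro x y w z
      rw [div_neg, ← neg_div]; ring
    simp only [Int.natAbs_neg, Int.cast_neg, neg_mul_neg, neg_div_neg_eq, e1, e2, neg_sq] at key
    rw [key]
    congr 3
    ring_nf
  · exact gsr_pos a b c ha h hev
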